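/- Let p₂ > 3 be a prime with p₂ ≡ 1 (mod 3), set q₂ = (p₂ − 1)/3 (which is even), and let p₃ be a prime with p₃ > 3p₂ and p₃ ≡ 2 (mod 3p₂); set q₃ = (p₃ − 2)/(3p₂). Let i = 3u + v with v ∈ {1, 2} and i < p₂ − 1. Then hw(f_{3p₂,p₃,i,q₃}) = 1 if 0 ≤ u ≤ q₂/2 − 1, and hw(f_{3p₂,p₃,i,q₃}) = 3 − v if q₂/2 ≤ u ≤ q₂ − 1. -/

import Mathlib

open Polynomial

/-- The Hamming weight of a polynomial: its number of nonzero coefficients. -/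
noncomputable def hw (f : Polynomial ℤ) : ℕ := f.support.card

/-- The last block `f_{3p₂,p₃,i,q₃}`: the polynomial of degree `< 2` whose coefficient of
`x^k` is the coefficient of `x^(i*p₃ + 3*p₂*q₃ + k)` in `Φ_{3p₂p₃}`, for `k = 0, 1`. -/
noncomputable def blockQ (p₂ p₃ i q₃ : ℕ) : Polynomial ℤ :=
  ∑ k ∈ Finset.range 2,
    C ((cyclotomic (3 * p₂ * p₃) ℤ).coeff (i * p₃ + 3 * p₂ * q₃ + k)) * X ^ k


theorem aux_m (p : ℕ) (hp : p.Prime) (h3 : 3 < p) :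
    cyclotomic (3 * p) ℤ * (1 + X + X ^ 2) = 1 + X ^ p + X ^ (2 * p) := by
  have h : ¬ p ∣ 3 := fun h => by
    have := Nat.le_of_dvd (by norm_num) h
    omega
  have := cyclotomic_expand_eq_cyclotomic_mul hp h ℤ
  rw [cyclotomic_three] at this
  simp only [map_add, map_pow, expand_X, map_one] at this
  rw [mul_comm 2 p, pow_mul]
  linear_combination -this

theorem aux_coeff (p : ℕ) (hp : p.Prime) (h3 : 3 < p) (n : ℕ) :
    (3 * n < p → (cyclotomic (3 * p) ℤ).coeff (3 * n) = 1) ∧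
    (3 * n + 1 < p → (cyclotomic (3 * p) ℤ).coeff (3 * n + 1) = -1) ∧
    (3 * n + 2 < p → (cyclotomic (3 * p) ℤ).coeff (3 * n + 2) = 0) := by
  have key := aux_m p hp h3
  set P := cyclotomic (3 * p) ℤ with hP
  have hrec : ∀ k, k + 2 < p → P.coeff (k + 2) + P.coeff (k + 1) + P.coeff k = 0 := by
    intro k hk
    have := congrArg (fun f => coeff f (k + 2)) key
    simp only [mul_add, mul_one, coeff_add, coeff_mul_X, coeff_mul_X_pow, coeff_X_pow,
      coeff_one] at this
    rw [if_neg (by omega), if_neg (by omega), if_neg (by omega)] at this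
    have e : P.coeff (k + 1 + 1) = P.coeff (k + 2) := rfl
    linarith
  have h0 : P.coeff 0 = 1 := by
    have := congrArg (fun f => coeff f 0) key
    simp [mul_coeff_zero, coeff_X_pow, coeff_one] at this
    rw [if_neg (by omega), if_neg (by omega)] at this
    linarith
  have h1 : P.coeff 1 = -1 := by
    have := congrArg (fun f => coeff f 1) key
    simp only [mul_add, mul_one, coeff_add, coeff_X_pow, coeff_one, coeff_mul_X_pow'] at this
    rw [show (1:ℕ) = 0 + 1 from rfl, coeff_mul_X] at this
    simp at this
    rw [if_neg (by omega), if_neg (by omega)] at this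
    linarith
  induction n with
  | zero =>
    refine ⟨fun _ => h0, fun _ => h1, fun h => ?_⟩
    have := hrec 0 h
    simp at this ⊢
    linarith
  | succ n ih =>
    have a : 3 * (n + 1) < p → P.coeff (3 * (n + 1)) = 1 := fun h => by
      have := hrec (3 * n + 1) (by omega)
      rw [ih.2.1 (by omega)] at this
      have e := ih.2.2 (by omega)
      simp only [Nat.mul_add, Nat.mul_one, Nat.add_assoc, Nat.reduceAdd] at *
      linarith
    have b : 3 * (n + 1) + 1 < p → P.coeff (3 * (n + 1) + 1) = -1 := fun h => by
      have := hrec (3 * n + 2) (by omega)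
      rw [ih.2.2 (by omega)] at this
      have e := a (by omega)
      simp only [Nat.mul_add, Nat.mul_one, Nat.add_assoc, Nat.reduceAdd] at *
      linarith
    refine ⟨a, b, fun h => ?_⟩
    have := hrec (3 * (n + 1)) (by omega)
    rw [a (by omega), b (by omega)] at this
    linarith

/-- The negated inverse cyclotomic polynomial. -/
noncomputable def gpoly (p : ℕ) : Polynomial ℤ := (1 + X + X ^ 2) * (1 - X ^ p)

theorem gpoly_coeff (p n : ℕ) : (gpoly p).coeff n =
    (if n = 0 then 1 else 0) + (if n = 1 then 1 else 0) + (if n = 2 then 1 else 0)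
    - (if n = p then 1 else 0) - (if n = p + 1 then 1 else 0) - (if n = p + 2 then 1 else 0) := by
  have : gpoly p = X ^ 0 + X ^ 1 + X ^ 2 - X ^ p - X ^ (p + 1) - X ^ (p + 2) := by
    unfold gpoly; ring
  rw [this]
  simp only [coeff_add, coeff_sub, coeff_X_pow]

theorem aux_series (p r : ℕ) (hp : p.Prime) (h3 : 3 < p) (hr : r.Prime) (hgt : 3 * p < r) :
    ((cyclotomic (3 * p * r) ℤ : ℤ[X]) : PowerSeries ℤ) =
      ((expand ℤ r (cyclotomic (3 * p) ℤ) : ℤ[X]) : PowerSeries ℤ) *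
        PowerSeries.mk (fun n => (gpoly p).coeff (n % (3 * p))) := by
  have hnd : ¬ r ∣ 3 * p := fun h => by
    have := Nat.le_of_dvd (by omega) h
    omega
  have h1 := cyclotomic_expand_eq_cyclotomic_mul hr hnd ℤ
  have h2 := aux_m p hp h3
  have h3' : cyclotomic (3 * p * r) ℤ * (1 - X ^ (3 * p)) =
      expand ℤ r (cyclotomic (3 * p) ℤ) * gpoly p := by
    rw [h1, gpoly]
    have e : (1 : ℤ[X]) - X ^ (3 * p) = (1 + X ^ p + X ^ (2 * p)) * (1 - X ^ p) := by ring
    rw [e, ← h2]; ring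
  have hG : PowerSeries.mk (fun n => (gpoly p).coeff (n % (3 * p))) *
      (1 - (PowerSeries.X : PowerSeries ℤ) ^ (3 * p)) = (gpoly p : PowerSeries ℤ) := by
    ext n
    rw [mul_sub, mul_one, map_sub, PowerSeries.coeff_mul_X_pow', PowerSeries.coeff_mk,
      Polynomial.coeff_coe]
    split_ifs with h
    · rw [PowerSeries.coeff_mk, ← Nat.mod_eq_sub_mod h, sub_self, gpoly_coeff]
      simp only [if_neg (show n ≠ 0 by omega), if_neg (show n ≠ 1 by omega),
        if_neg (show n ≠ 2 by omega), if_neg (show n ≠ p by omega),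
        if_neg (show n ≠ p + 1 by omega), if_neg (show n ≠ p + 2 by omega)]
      simp
    · rw [Nat.mod_eq_of_lt (by omega), sub_zero]
  have hne : (1 - (PowerSeries.X : PowerSeries ℤ) ^ (3 * p)) ≠ 0 := by
    intro h
    have := congrArg (PowerSeries.coeff 0) h
    rw [map_sub, PowerSeries.coeff_X_pow, if_neg (by omega)] at this
    simp at this
  apply mul_right_cancel₀ hne
  rw [mul_assoc (_ : PowerSeries ℤ) (PowerSeries.mk _) _, hG]
  have := congrArg (fun f : ℤ[X] => (f : PowerSeries ℤ)) h3'
  simpa using this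

theorem aux_sum (p r q : ℕ) (hp : p.Prime) (h3 : 3 < p) (hr : r.Prime) (hgt : 3 * p < r)
    (hq : 3 * p * q + 2 = r) (i k : ℕ) (hi : i < p - 1) (hk : k < 2) :
    (cyclotomic (3 * p * r) ℤ).coeff (i * r + 3 * p * q + k) =
      ∑ d ∈ Finset.range (i + 1),
        (cyclotomic (3 * p) ℤ).coeff (i - d) * (gpoly p).coeff (2 * d + k) := by
  rw [← Polynomial.coeff_coe, aux_series p r hp h3 hr hgt]
  set P := cyclotomic (3 * p) ℤ with hP
  obtain ⟨M, hM⟩ : ∃ M, M = P.natDegree + 1 + (i + 1) := ⟨_, rfl⟩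
  have hs : ((expand ℤ r P : ℤ[X]) : PowerSeries ℤ) =
      ∑ j ∈ Finset.range M, PowerSeries.C (P.coeff j) * PowerSeries.X ^ (j * r) := by
    conv_lhs => rw [P.as_sum_range_C_mul_X_pow' (n := M) (by omega)]
    rw [map_sum, ← Polynomial.coeToPowerSeries.ringHom_apply, map_sum]
    refine Finset.sum_congr rfl fun j _ => ?_
    simp only [map_mul, map_pow, expand_C, expand_X, coeToPowerSeries.ringHom_apply, coe_C, coe_X,
      ← pow_mul, mul_comm]
  rw [hs, Finset.sum_mul, map_sum,
    ← Finset.sum_range_reflect (fun d => P.coeff (i - d) * (gpoly p).coeff (2 * d + k))]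
  symm
  have hsub : Finset.range (i + 1) ⊆ Finset.range M := by
    intro x; simp only [Finset.mem_range]; omega
  apply Finset.sum_subset_zero_on_sdiff hsub
  · intro j hj
    simp only [Finset.mem_sdiff, Finset.mem_range] at hj
    rw [mul_assoc (PowerSeries.C _), PowerSeries.coeff_C_mul, PowerSeries.coeff_X_pow_mul', if_neg, mul_zero]
    have : (i + 1) * r ≤ j * r := Nat.mul_le_mul_right _ (by omega)
    rw [add_mul, one_mul] at this
    omega
  · intro j hj
    simp only [Finset.mem_range] at hj
    obtain ⟨d, rfl⟩ : ∃ d, i = j + d := ⟨i - j, by omega⟩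
    rw [mul_assoc (PowerSeries.C _), PowerSeries.coeff_C_mul, PowerSeries.coeff_X_pow_mul', if_pos,
      PowerSeries.coeff_mk]
    · rw [show j + d - (j + d + 1 - 1 - j) = j by omega,
        show j + d + 1 - 1 - j = d by omega]
      congr 2
      have : (j + d) * r + 3 * p * q + k - j * r = (2 * d + k) + 3 * p * (d * q + q) := by
        have : (j + d) * r + 3 * p * q + k = (2 * d + k) + 3 * p * (d * q + q) + j * r := by
          rw [← hq]; ring
        omega
      rw [this, Nat.add_mul_mod_self_left, Nat.mod_eq_of_lt (by omega)]
    · rw [add_mul]; omega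

theorem hw_block (p r i q : ℕ) (a b : ℤ)
    (ha : (cyclotomic (3 * p * r) ℤ).coeff (i * r + 3 * p * q + 0) = a)
    (hb : (cyclotomic (3 * p * r) ℤ).coeff (i * r + 3 * p * q + 1) = b) :
    hw (blockQ p r i q) = (if a = 0 then 0 else 1) + (if b = 0 then 0 else 1) := by
  have hc : ∀ n, (blockQ p r i q).coeff n = if n = 0 then a else if n = 1 then b else 0 := by
    intro n
    unfold blockQ
    rw [Finset.sum_range_succ, Finset.sum_range_one, ha, hb]
    simp only [coeff_add, coeff_C_mul, coeff_X_pow]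
    rcases n with _ | _ | n <;> simp
  have : (blockQ p r i q).support =
      (if a = 0 then ∅ else {0}) ∪ (if b = 0 then ∅ else {1}) := by
    ext n
    rw [mem_support_iff, hc]
    rcases n with _ | _ | n <;> split_ifs <;> simp_all
  unfold hw
  rw [this]
  split_ifs <;> simp

theorem sum_pick (i t : ℕ) (F : ℕ → ℤ) :
    ∑ d ∈ Finset.range (i + 1), F (i - d) * (if d = t then 1 else 0) =
      if t ≤ i then F (i - t) else 0 := by
  simp

theorem aux_c0 (i s : ℕ) (F : ℕ → ℤ) (hs : 0 < s) :
    ∑ d ∈ Finset.range (i + 1), F (i - d) * (gpoly (6 * s + 1)).coeff (2 * d + 0) =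
      F i + (if 1 ≤ i then F (i - 1) else 0) -
        (if 3 * s + 1 ≤ i then F (i - (3 * s + 1)) else 0) := by
  rw [← sum_pick i 1 F, ← sum_pick i (3 * s + 1) F]
  have := sum_pick i 0 F
  rw [if_pos (Nat.zero_le _), Nat.sub_zero] at this
  rw [← this, ← Finset.sum_add_distrib, ← Finset.sum_sub_distrib]
  refine Finset.sum_congr rfl fun d _ => ?_
  rw [gpoly_coeff, ← mul_add, ← mul_sub]
  congr 1
  split_ifs <;> omega

theorem aux_c1 (i s : ℕ) (F : ℕ → ℤ) (hs : 0 < s) :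
    ∑ d ∈ Finset.range (i + 1), F (i - d) * (gpoly (6 * s + 1)).coeff (2 * d + 1) =
      F i - (if 3 * s ≤ i then F (i - 3 * s) else 0) -
        (if 3 * s + 1 ≤ i then F (i - (3 * s + 1)) else 0) := by
  rw [← sum_pick i (3 * s) F, ← sum_pick i (3 * s + 1) F]
  have := sum_pick i 0 F
  rw [if_pos (Nat.zero_le _), Nat.sub_zero] at this
  rw [← this, ← Finset.sum_sub_distrib, ← Finset.sum_sub_distrib]
  refine Finset.sum_congr rfl fun d _ => ?_
  rw [gpoly_coeff, ← mul_sub, ← mul_sub]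
  congr 1
  rw [if_neg (show ¬ 2 * d + 1 = 0 by omega), if_neg (show ¬ 2 * d + 1 = 2 by omega),
    if_neg (show ¬ 2 * d + 1 = 6 * s + 1 + 1 by omega)]
  simp only [show 2 * d + 1 = 1 ↔ d = 0 by omega, show 2 * d + 1 = 6 * s + 1 ↔ d = 3 * s by omega,
    show 2 * d + 1 = 6 * s + 1 + 2 ↔ d = 3 * s + 1 by omega]
  ring

theorem stmt12 (p₂ p₃ q₂ q₃ : ℕ) (hp₂ : p₂.Prime) (h3 : 3 < p₂) (hq₂ : 3 * q₂ + 1 = p₂)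
    (hp₃ : p₃.Prime) (hgt : 3 * p₂ < p₃) (hmod : p₃ % (3 * p₂) = 2)
    (hq₃ : 3 * p₂ * q₃ + 2 = p₃)
    (u v i : ℕ) (hv : v = 1 ∨ v = 2) (hiv : i = 3 * u + v) (hi : i < p₂ - 1) :
    (u ≤ q₂ / 2 - 1 → hw (blockQ p₂ p₃ i q₃) = 1) ∧
    (q₂ / 2 ≤ u → u ≤ q₂ - 1 → hw (blockQ p₂ p₃ i q₃) = 3 - v) := by
  have hodd : p₂ % 2 = 1 := by
    rcases hp₂.eq_two_or_odd with h | h <;> omega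
  obtain ⟨s, rfl⟩ : ∃ s, q₂ = 2 * s := ⟨q₂ / 2, by omega⟩
  obtain rfl : p₂ = 6 * s + 1 := by omega
  have hs : 0 < s := by omega
  have e0 := aux_sum _ p₃ q₃ hp₂ h3 hp₃ hgt hq₃ i 0 hi (by omega)
  have e1 := aux_sum _ p₃ q₃ hp₂ h3 hp₃ hgt hq₃ i 1 hi (by omega)
  rw [aux_c0 _ _ (fun j => (cyclotomic (3 * (6 * s + 1)) ℤ).coeff j) hs] at e0
  rw [aux_c1 _ _ (fun j => (cyclotomic (3 * (6 * s + 1)) ℤ).coeff j) hs] at e1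
  have hw' := hw_block _ _ _ _ _ _ e0 e1
  have A := aux_coeff _ hp₂ h3
  have cu := A u
  rw [hw']
  constructor
  · intro hu
    rw [if_neg (show ¬ 3 * s + 1 ≤ i by omega), if_neg (show ¬ 3 * s ≤ i by omega),
      if_pos (show 1 ≤ i by omega)]
    rcases hv with rfl | rfl
    · subst hiv
      simp [cu.1 (by omega), cu.2.1 (by omega)]
    · subst hiv
      simp [cu.2.2 (by omega), cu.2.1 (by omega)]
  · intro hu _
    obtain ⟨w, rfl⟩ : ∃ w, u = s + w := ⟨u - s, by omega⟩
    have cw := A w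
    rw [if_pos (show 3 * s + 1 ≤ i by omega), if_pos (show 3 * s ≤ i by omega),
      if_pos (show 1 ≤ i by omega)]
    rcases hv with rfl | rfl
    · subst hiv
      rw [show 3 * (s + w) + 1 - 3 * s = 3 * w + 1 by omega,
        show 3 * (s + w) + 1 - (3 * s + 1) = 3 * w by omega,
        show 3 * (s + w) + 1 - 1 = 3 * (s + w) by omega,
        cu.1 (by omega), cu.2.1 (by omega), cw.1 (by omega), cw.2.1 (by omega)]
      norm_num
    · subst hiv
      rw [show 3 * (s + w) + 2 - 3 * s = 3 * w + 2 by omega,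
        show 3 * (s + w) + 2 - (3 * s + 1) = 3 * w + 1 by omega,
        show 3 * (s + w) + 2 - 1 = 3 * (s + w) + 1 by omega,
        cu.2.2 (by omega), cu.2.1 (by omega), cw.2.2 (by omega), cw.2.1 (by omega)]
      norm_num
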